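/- Let (f,g) be a slice trajectory on a closed interval I. For real x set T_x = inf{t ∈ I : f(t) = −x}. Let −f(inf I) ≤ L ≤ L' ≤ −inf_I f in the extended real line, with the conventions T_L = inf I when inf I = −∞ and L = −∞, and T_{L'} = sup I when sup I = +∞ and L' = +∞. Set J = [T_L, T_{L'}] ∩ I. Then for all s, t ∈ J, D_{f|J, g|J}(s,t) = D_{f,g}(s,t); that is, the quotient pseudometric computed from the restricted pair (f|J, g|J) is the restriction to J × J of the quotient pseudometric computed from (f,g). -/

import Mathlib

open scoped ENNReal

/-- The tree pseudometric `d_f(s,t) = f(s) + f(t) − 2·inf{f(u) : s∧t ≤ u ≤ s∨t}`. -/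
noncomputable def dOf (f : ℝ → ℝ) (s t : ℝ) : ℝ :=
  f s + f t - 2 * sInf (f '' Set.Icc (min s t) (max s t))

/-- The quotient pseudometric `d/R`, with chain points constrained to lie in `S`. -/
noncomputable def quotDistOn {α : Type*} (d : α → α → ℝ≥0∞) (R : α → α → Prop)
    (S : Set α) (x y : α) : ℝ≥0∞ :=
  ⨅ (n : ℕ) (a : Fin (n + 1) → α) (b : Fin (n + 1) → α)
    (_ : ∀ i, a i ∈ S) (_ : ∀ i, b i ∈ S)
    (_ : a 0 = x) (_ : b (Fin.last n) = y)
    (_ : ∀ i : Fin n, R (b i.castSucc) (a i.succ)),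
    ∑ i, d (a i) (b i)

/-- The quotient pseudometric `D_{f,g} = d_g / {d_f = 0}` on the set `J`. -/
noncomputable def Dquot (f g : ℝ → ℝ) (J : Set ℝ) : ℝ → ℝ → ℝ≥0∞ :=
  quotDistOn (fun s t => ENNReal.ofReal (dOf g s t)) (fun s t => dOf f s t = 0) J

/-- A slice trajectory. -/
def IsSliceTrajectory (I : Set ℝ) (f g : ℝ → ℝ) : Prop :=
  IsClosed I ∧ I.OrdConnected ∧ I.Nonempty ∧
  ContinuousOn f I ∧ ContinuousOn g I ∧
  (∀ s ∈ I, ∀ t ∈ I, dOf f s t = 0 → g s = g t) ∧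
  (¬ BddBelow I →
    Filter.Tendsto f (Filter.atBot ⊓ Filter.principal I) Filter.atTop ∧
    ¬ BddBelow (g '' (I ∩ Set.Iic 0))) ∧
  (¬ BddAbove I →
    ¬ BddBelow (f '' (I ∩ Set.Ici 0)) ∧ ¬ BddBelow (g '' (I ∩ Set.Ici 0)))

/-- `T_x = inf{t ∈ I : f(t) = −x}`. -/
noncomputable def hitT (I : Set ℝ) (f : ℝ → ℝ) (x : ℝ) : ℝ :=
  sInf {t | t ∈ I ∧ f t = -x}

/-- The window `J = [T_L, T_{L'}] ∩ I` for extended-real levels `L ≤ L'`, with the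
conventions `T_L = inf I` when `L = −∞` and `T_{L'} = sup I` when `L' = +∞`. -/
def sliceWindow (I : Set ℝ) (f : ℝ → ℝ) (L L' : EReal) : Set ℝ :=
  {t | t ∈ I ∧ (∀ l : ℝ, L = (l : EReal) → hitT I f l ≤ t) ∧
    (∀ l : ℝ, L' = (l : EReal) → t ≤ hitT I f l)}

open Set Filter Topology

/-- `ChainCost d R S y x c`: some chain in `S` from `x` to `y`, with jumps along `R`, has cost
`c`. -/
inductive ChainCost {α : Type*} (d : α → α → ℝ) (R : α → α → Prop) (S : Set α) (y : α) :
    α → ℝ → Prop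
  | single {x : α} (hx : x ∈ S) (hy : y ∈ S) : ChainCost d R S y x (d x y)
  | cons {x b a : α} {c : ℝ} (hx : x ∈ S) (hb : b ∈ S) (hR : R b a)
      (h : ChainCost d R S y a c) : ChainCost d R S y x (d x b + c)

section Chains

variable {α : Type*} {d : α → α → ℝ} {R : α → α → Prop} {S : Set α} {x y : α} {c : ℝ}

lemma ChainCost.nonneg (hd : ∀ u ∈ S, ∀ v ∈ S, 0 ≤ d u v) (h : ChainCost d R S y x c) :
    0 ≤ c := by
  induction h with
  | single hx hy => exact hd _ hx _ hy
  | cons hx hb _ _ ih => exact add_nonneg (hd _ hx _ hb) ih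

lemma ChainCost.exists_fin (hd : ∀ u ∈ S, ∀ v ∈ S, 0 ≤ d u v) (h : ChainCost d R S y x c) :
    ∃ (n : ℕ) (a b : Fin (n + 1) → α), (∀ i, a i ∈ S) ∧ (∀ i, b i ∈ S) ∧ a 0 = x ∧
      b (Fin.last n) = y ∧ (∀ i : Fin n, R (b i.castSucc) (a i.succ)) ∧
      ∑ i, ENNReal.ofReal (d (a i) (b i)) = ENNReal.ofReal c := by
  induction h with
  | @single x hx hy =>
    exact ⟨0, fun _ => x, fun _ => y, fun _ => hx, fun _ => hy, rfl, rfl, fun i => i.elim0,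
      by simp⟩
  | @cons x b₀ a₀ c hx hb hR h ih =>
    obtain ⟨n, a, b, ha, hb', ha0, hbn, hRab, hsum⟩ := ih
    refine ⟨n + 1, Fin.cons x a, Fin.cons b₀ b, ?_, ?_, rfl, ?_, ?_, ?_⟩
    · exact Fin.cases hx ha
    · exact Fin.cases hb hb'
    · rw [← Fin.succ_last, Fin.cons_succ, hbn]
    · refine Fin.cases ?_ fun i => ?_
      · simpa [ha0] using hR
      · rw [Fin.cons_succ, ← Fin.succ_castSucc, Fin.cons_succ]
        exact hRab i
    · rw [Fin.sum_univ_succ, ENNReal.ofReal_add (hd _ hx _ hb) (h.nonneg hd)]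
      simp only [Fin.cons_zero, Fin.cons_succ, hsum]

lemma ChainCost.quotDistOn_le (hd : ∀ u ∈ S, ∀ v ∈ S, 0 ≤ d u v) (h : ChainCost d R S y x c) :
    quotDistOn (fun s t => ENNReal.ofReal (d s t)) R S x y ≤ ENNReal.ofReal c := by
  obtain ⟨n, a, b, ha, hb, ha0, hbn, hR, hsum⟩ := h.exists_fin hd
  rw [← hsum]
  exact iInf_le_of_le n <| iInf_le_of_le a <| iInf_le_of_le b <| iInf_le_of_le ha <|
    iInf_le_of_le hb <| iInf_le_of_le ha0 <| iInf_le_of_le hbn <| iInf_le_of_le hR le_rfl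

lemma exists_chainCost_of_fin (n : ℕ) (a b : Fin (n + 1) → α) (ha : ∀ i, a i ∈ S)
    (hb : ∀ i, b i ∈ S) (hR : ∀ i : Fin n, R (b i.castSucc) (a i.succ)) :
    ∃ c, ChainCost d R S (b (Fin.last n)) (a 0) c ∧
      ENNReal.ofReal c ≤ ∑ i, ENNReal.ofReal (d (a i) (b i)) := by
  induction n with
  | zero => exact ⟨_, .single (ha 0) (hb _), by simp⟩
  | succ n ih =>
    obtain ⟨c, hc, hle⟩ := ih (fun i => a i.succ) (fun i => b i.succ) (fun i => ha _)
      (fun i => hb _) (fun i => hR i.succ)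
    refine ⟨d (a 0) (b 0) + c, .cons (ha 0) (hb 0) (hR 0) hc, ?_⟩
    rw [Fin.sum_univ_succ]
    exact ENNReal.ofReal_add_le.trans (by gcongr)

lemma le_quotDistOn {r : ℝ≥0∞}
    (h : ∀ c, ChainCost d R S y x c → r ≤ ENNReal.ofReal c) :
    r ≤ quotDistOn (fun s t => ENNReal.ofReal (d s t)) R S x y := by
  refine le_iInf fun n => le_iInf fun a => le_iInf fun b => le_iInf fun ha => le_iInf fun hb =>
    le_iInf fun ha0 => le_iInf fun hbn => le_iInf fun hR => ?_
  obtain ⟨c, hc, hle⟩ := exists_chainCost_of_fin (d := d) n a b ha hb hR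
  rw [ha0, hbn] at hc
  exact (h c hc).trans hle

lemma quotDistOn_anti {d : α → α → ℝ≥0∞} {K : Set α} (hKS : K ⊆ S) :
    quotDistOn d R S x y ≤ quotDistOn d R K x y := by
  refine le_iInf fun n => le_iInf fun a => le_iInf fun b => le_iInf fun ha => le_iInf fun hb =>
    le_iInf fun ha0 => le_iInf fun hbn => le_iInf fun hR => ?_
  exact iInf_le_of_le n <| iInf_le_of_le a <| iInf_le_of_le b <|
    iInf_le_of_le (fun i => hKS (ha i)) <| iInf_le_of_le (fun i => hKS (hb i)) <|
    iInf_le_of_le ha0 <| iInf_le_of_le hbn <| iInf_le_of_le hR le_rfl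

end Chains

section TreeDistance

variable {S : Set ℝ} {f : ℝ → ℝ} {s t : ℝ}

lemma dOf_self (f : ℝ → ℝ) (s : ℝ) : dOf f s s = 0 := by
  simp [dOf]; ring

lemma dOf_comm (f : ℝ → ℝ) (s t : ℝ) : dOf f s t = dOf f t s := by
  simp only [dOf, min_comm s t, max_comm s t]; ring

/-- `d_f(s,t) = f(s) + f(t) - 2m` with `m` the minimum of `f` between `s` and `t`. -/
lemma exists_dOf_eq (hS : S.OrdConnected) (hf : ContinuousOn f S) (hs : s ∈ S) (ht : t ∈ S) :
    ∃ m, dOf f s t = f s + f t - 2 * m ∧ (∀ u ∈ uIcc s t, m ≤ f u) ∧ ∃ u ∈ uIcc s t, f u = m := by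
  have hne : (uIcc s t).Nonempty := nonempty_uIcc
  obtain ⟨u, hu, hmin⟩ := isCompact_uIcc.exists_isMinOn hne (hf.mono (hS.uIcc_subset hs ht))
  have hle : IsLeast (f '' uIcc s t) (f u) := ⟨mem_image_of_mem f hu, by
    rintro _ ⟨v, hv, rfl⟩
    exact hmin hv⟩
  refine ⟨f u, ?_, fun v hv => hmin hv, u, hu, rfl⟩
  have : sInf (f '' Icc (min s t) (max s t)) = f u := hle.csInf_eq
  rw [dOf, this]

lemma abs_sub_le_dOf (hS : S.OrdConnected) (hf : ContinuousOn f S) (hs : s ∈ S) (ht : t ∈ S) :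
    |f s - f t| ≤ dOf f s t := by
  obtain ⟨m, hm, hle, -⟩ := exists_dOf_eq hS hf hs ht
  have h1 := hle s left_mem_uIcc
  have h2 := hle t right_mem_uIcc
  rw [hm, abs_le]
  constructor <;> linarith

lemma dOf_nonneg (hS : S.OrdConnected) (hf : ContinuousOn f S) (hs : s ∈ S) (ht : t ∈ S) :
    0 ≤ dOf f s t :=
  (abs_nonneg _).trans (abs_sub_le_dOf hS hf hs ht)

lemma dOf_le_of_le (hS : S.OrdConnected) (hf : ContinuousOn f S) (hs : s ∈ S) (ht : t ∈ S)
    {m : ℝ} (h : ∀ u ∈ uIcc s t, m ≤ f u) : dOf f s t ≤ f s + f t - 2 * m := by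
  obtain ⟨m', hm', -, u, hu, rfl⟩ := exists_dOf_eq hS hf hs ht
  have := h u hu
  linarith

lemma le_of_dOf_eq_zero (hS : S.OrdConnected) (hf : ContinuousOn f S) (hs : s ∈ S) (ht : t ∈ S)
    (h : dOf f s t = 0) {u : ℝ} (hu : u ∈ uIcc s t) : f s ≤ f u ∧ f t ≤ f u := by
  obtain ⟨m, hm, hle, -⟩ := exists_dOf_eq hS hf hs ht
  have h1 := hle s left_mem_uIcc
  have h2 := hle t right_mem_uIcc
  have h3 := hle u hu
  constructor <;> linarith

end TreeDistance

section Cut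

variable {S K : Set ℝ} {g : ℝ → ℝ} {R : ℝ → ℝ → Prop} {p t : ℝ}

/-- A lower bound, in terms of the part of a chain inside `K`, for the cost `c` of a chain from `x`
to `t`; when `x ∉ K`, `b` is the point where the chain enters `K` and `m` a level below which it
has to descend before that. -/
def CutBound (g : ℝ → ℝ) (R : ℝ → ℝ → Prop) (K : Set ℝ) (p t x c : ℝ) : Prop :=
  (x ∈ K → ∃ c' ≤ c, ChainCost (dOf g) R K t x c') ∧
  (x ∉ K → ∃ b ∈ K, ∃ m c', ChainCost (dOf g) R K t b c' ∧ (∀ u ∈ uIcc p b, m ≤ g u) ∧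
    |g x - m| + (g b - m) + c' ≤ c)

lemma CutBound.jump (hS : S.OrdConnected) (hg : ContinuousOn g S) (hKS : K ⊆ S) (hp : p ∈ K)
    (hRrefl : ∀ x, R x x) (hRg : ∀ x ∈ S, ∀ y ∈ S, R x y → g x = g y)
    (hcross : ∀ x ∈ K, ∀ y ∈ S \ K, R x y → x = p)
    (hcross' : ∀ x ∈ K, ∀ y ∈ S \ K, R y x → x = p)
    {a b c : ℝ} (ha : a ∈ S) (hb : b ∈ S) (hR : R b a) (h : CutBound g R K p t a c) :
    CutBound g R K p t b c := by
  have hgab := hRg b hb a ha hR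
  refine ⟨fun hbK => ?_, fun hbK => ?_⟩
  · by_cases haK : a ∈ K
    · obtain ⟨c', hc', hch⟩ := h.1 haK
      refine ⟨_, ?_, .cons hbK hbK hR hch⟩
      rwa [dOf_self, zero_add]
    · obtain rfl := hcross b hbK a ⟨ha, haK⟩ hR
      obtain ⟨e, heK, m, c', hch, hm, hle⟩ := h.2 haK
      refine ⟨_, ?_, .cons hp heK (hRrefl e) hch⟩
      have h1 := dOf_le_of_le hS hg hb (hKS heK) hm
      have h2 := le_abs_self (g a - m)
      linarith
  · by_cases haK : a ∈ K
    · obtain rfl := hcross' a haK b ⟨hb, hbK⟩ hR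
      obtain ⟨c', hc', hch⟩ := h.1 haK
      refine ⟨a, hp, g a, c', hch, ?_, ?_⟩
      · simp
      · simpa [hgab] using hc'
    · obtain ⟨e, heK, m, c', hch, hm, hle⟩ := h.2 haK
      exact ⟨e, heK, m, c', hch, hm, by rwa [hgab]⟩

lemma CutBound.step (hS : S.OrdConnected) (hg : ContinuousOn g S) (hKS : K ⊆ S)
    (hsep : ∀ x ∈ K, ∀ y ∈ S \ K, p ∈ uIcc x y) (hRrefl : ∀ x, R x x)
    {x b c : ℝ} (hx : x ∈ S) (hb : b ∈ S) (h : CutBound g R K p t b c) :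
    CutBound g R K p t x (dOf g x b + c) := by
  refine ⟨fun hxK => ?_, fun hxK => ?_⟩
  · by_cases hbK : b ∈ K
    · obtain ⟨c', hc', hch⟩ := h.1 hbK
      exact ⟨_, by linarith, .cons hxK hbK (hRrefl b) hch⟩
    · obtain ⟨e, heK, m, c', hch, hm, hle⟩ := h.2 hbK
      obtain ⟨m₁, hd, hm₁, -⟩ := exists_dOf_eq hS hg hx hb
      have hpx := hsep x hxK b ⟨hb, hbK⟩
      refine ⟨_, ?_, .cons hxK heK (hRrefl e) hch⟩
      have h1 : dOf g x e ≤ g x + g e - 2 * min m₁ m := by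
        refine dOf_le_of_le hS hg hx (hKS heK) fun u hu => ?_
        rcases uIcc_subset_uIcc_union_uIcc (b := p) hu with hu | hu
        · exact (min_le_left _ _).trans (hm₁ u (uIcc_subset_uIcc_left hpx hu))
        · exact (min_le_right _ _).trans (hm u hu)
      have h2 := hm₁ b right_mem_uIcc
      rcases le_total m₁ m with h3 | h3
      · rw [min_eq_left h3] at h1
        have := neg_abs_le (g b - m)
        linarith
      · rw [min_eq_right h3] at h1
        have := le_abs_self (g b - m)
        linarith
  · by_cases hbK : b ∈ K
    · obtain ⟨c', hc', hch⟩ := h.1 hbK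
      obtain ⟨m, hd, hm, -⟩ := exists_dOf_eq hS hg hx hb
      have hpx := hsep b hbK x ⟨hx, hxK⟩
      rw [uIcc_comm] at hpx
      refine ⟨b, hbK, m, c', hch, fun u hu => hm u (uIcc_subset_uIcc_right hpx hu), ?_⟩
      rw [abs_of_nonneg (sub_nonneg.2 (hm x left_mem_uIcc))]
      linarith
    · obtain ⟨e, heK, m, c', hch, hm, hle⟩ := h.2 hbK
      refine ⟨e, heK, m, c', hch, hm, ?_⟩
      have h1 := abs_sub_le_dOf hS hg hx hb
      have h2 := abs_sub_le (g x) (g b) m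
      linarith

/-- Cutting `S` at a point `p` does not change the quotient pseudometric on the remaining part
`K` if no point of `K` other than `p` is identified with a point of `S \ K`. -/
lemma quotDistOn_eq_of_cut (hS : S.OrdConnected) (hg : ContinuousOn g S) (hKS : K ⊆ S)
    (hp : p ∈ K) (hsep : ∀ x ∈ K, ∀ y ∈ S \ K, p ∈ uIcc x y) (hRrefl : ∀ x, R x x)
    (hRg : ∀ x ∈ S, ∀ y ∈ S, R x y → g x = g y)
    (hcross : ∀ x ∈ K, ∀ y ∈ S \ K, R x y → x = p)
    (hcross' : ∀ x ∈ K, ∀ y ∈ S \ K, R y x → x = p)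
    {s : ℝ} (hs : s ∈ K) (ht : t ∈ K) :
    quotDistOn (fun s t => ENNReal.ofReal (dOf g s t)) R K s t =
      quotDistOn (fun s t => ENNReal.ofReal (dOf g s t)) R S s t := by
  refine le_antisymm (le_quotDistOn fun c hc => ?_) (quotDistOn_anti hKS)
  have key : s ∈ S ∧ CutBound g R K p t s c := by
    clear hs
    induction hc with
    | single hx hy =>
      refine ⟨hx, ?_⟩
      have h0 : CutBound g R K p t t 0 :=
        ⟨fun h => ⟨_, (dOf_self g t).le, .single h h⟩, fun h => absurd ht h⟩
      simpa using CutBound.step hS hg hKS hsep hRrefl hx hy h0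
    | cons hx hb hR _ ih =>
      exact ⟨hx, CutBound.step hS hg hKS hsep hRrefl hx hb
        (CutBound.jump hS hg hKS hp hRrefl hRg hcross hcross' ih.1 hb hR ih.2)⟩
  obtain ⟨c', hle, hch⟩ := key.2.1 hs
  exact (hch.quotDistOn_le fun u hu v hv => dOf_nonneg hS hg (hKS hu) (hKS hv)).trans
    (ENNReal.ofReal_le_ofReal hle)

end Cut

section Hitting

variable {I : Set ℝ} {f g : ℝ → ℝ} {l : ℝ}

lemma hitT_spec (hI : IsClosed I) (hIc : I.OrdConnected) (hf : ContinuousOn f I)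
    (hhigh : ∀ t ∈ I, ∃ u ∈ I, u ≤ t ∧ -l ≤ f u) (hlow : ∃ t ∈ I, f t ≤ -l)
    (hbdd : BddBelow {t | t ∈ I ∧ f t = -l}) :
    hitT I f l ∈ I ∧ f (hitT I f l) = -l ∧ ∀ t ∈ I, t < hitT I f l → -l < f t := by
  have hex : ∀ t ∈ I, f t ≤ -l → ∃ u, (u ∈ I ∧ f u = -l) ∧ u ≤ t := by
    intro t ht hft
    obtain ⟨u, hu, hut, hfu⟩ := hhigh t ht
    have hsub := hIc.out hu ht
    obtain ⟨v, hv, hfv⟩ := intermediate_value_Icc' hut (hf.mono hsub) ⟨hft, hfu⟩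
    exact ⟨v, ⟨hsub hv, hfv⟩, hv.2⟩
  have hclosed : IsClosed {t | t ∈ I ∧ f t = -l} :=
    hf.preimage_isClosed_of_isClosed hI (isClosed_singleton (x := -l))
  have hmem : hitT I f l ∈ {t | t ∈ I ∧ f t = -l} := by
    obtain ⟨t, ht, hft⟩ := hlow
    obtain ⟨u, hu, -⟩ := hex t ht hft
    exact hclosed.csInf_mem ⟨u, hu⟩ hbdd
  refine ⟨hmem.1, hmem.2, fun t ht htT => ?_⟩
  by_contra! hft
  obtain ⟨u, hu, hut⟩ := hex t ht hft
  exact (hut.trans_lt htT).not_ge (csInf_le hbdd hu)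

lemma IsSliceTrajectory.hitT_spec (h : IsSliceTrajectory I f g) {L L' : EReal}
    (hlow : BddBelow I → ((-f (sInf I) : ℝ) : EReal) ≤ L)
    (hup : (⨅ t ∈ I, (f t : EReal)) ≤ -L') (hLl : L ≤ l) (hlL' : (l : EReal) ≤ L') :
    hitT I f l ∈ I ∧ f (hitT I f l) = -l ∧ ∀ t ∈ I, t < hitT I f l → -l < f t := by
  obtain ⟨hI, hIc, hne, hf, -, -, hbot, htop⟩ := h
  have hev (hb : ¬ BddBelow I) (r : ℝ) : ∃ N, ∀ t ≤ N, t ∈ I → r < f t := by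
    have := (hbot hb).1.eventually (eventually_gt_atTop r)
    rw [eventually_inf_principal] at this
    exact eventually_atBot.1 this
  refine _root_.hitT_spec hI hIc hf (fun t ht => ?_) ?_ ?_
  · by_cases hb : BddBelow I
    · refine ⟨sInf I, hI.csInf_mem hne hb, csInf_le hb ht, ?_⟩
      have : -f (sInf I) ≤ l := EReal.coe_le_coe_iff.1 ((hlow hb).trans hLl)
      linarith
    · obtain ⟨N, hN⟩ := hev hb (-l)
      obtain ⟨u, hu, huN⟩ := not_bddBelow_iff.1 hb (min N t)
      exact ⟨u, hu, huN.le.trans (min_le_right _ _),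
        (hN u (huN.le.trans (min_le_left _ _)) hu).le⟩
  · by_cases ha : BddAbove I
    · obtain ⟨x₀, hx₀⟩ := hne
      have hev' : ∀ᶠ x in cocompact ℝ ⊓ 𝓟 I, f x₀ ≤ f x := by
        rw [eventually_inf_principal, cocompact_eq_atBot_atTop, eventually_sup]
        constructor
        · by_cases hb : BddBelow I
          · obtain ⟨N, hN⟩ := hb
            filter_upwards [eventually_lt_atBot N] with x hx hxI
            exact absurd (hN hxI) hx.not_ge
          · obtain ⟨N, hN⟩ := hev hb (f x₀)
            filter_upwards [eventually_le_atBot N] with x hx hxI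
            exact (hN x hx hxI).le
        · obtain ⟨N, hN⟩ := ha
          filter_upwards [eventually_gt_atTop N] with x hx hxI
          exact absurd (hN hxI) hx.not_ge
      obtain ⟨x, hx, hmin⟩ := hf.exists_isMinOn' hI hx₀ hev'
      refine ⟨x, hx, ?_⟩
      have h1 : (f x : EReal) ≤ ⨅ t ∈ I, (f t : EReal) :=
        le_iInf₂ fun t ht => EReal.coe_le_coe_iff.2 (hmin ht)
      have h2 : (f x : EReal) ≤ ((-l : ℝ) : EReal) :=
        (h1.trans hup).trans (by rw [EReal.coe_neg]; exact EReal.neg_le_neg_iff.2 hlL')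
      exact EReal.coe_le_coe_iff.1 h2
    · obtain ⟨_, ⟨t, ht, rfl⟩, hlt⟩ := not_bddBelow_iff.1 (htop ha).1 (-l)
      exact ⟨t, ht.1, hlt.le⟩
  · by_cases hb : BddBelow I
    · exact hb.mono fun t ht => ht.1
    · obtain ⟨N, hN⟩ := hev hb (-l)
      refine ⟨N, fun t ht => ?_⟩
      by_contra! htN
      exact (hN t htN.le ht.1).ne' ht.2

end Hitting

section OneSided

variable {S : Set ℝ} {f g : ℝ → ℝ} {p s t : ℝ}

lemma Dquot_inter_Iic (hS : S.OrdConnected) (hf : ContinuousOn f S) (hg : ContinuousOn g S)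
    (hfg : ∀ s ∈ S, ∀ t ∈ S, dOf f s t = 0 → g s = g t) (hp : p ∈ S)
    (hhit : ∀ t ∈ S, t < p → f p < f t) (hs : s ∈ S ∩ Iic p) (ht : t ∈ S ∩ Iic p) :
    Dquot f g (S ∩ Iic p) s t = Dquot f g S s t := by
  have hsep : ∀ x ∈ S ∩ Iic p, ∀ y ∈ S \ (S ∩ Iic p), p ∈ uIcc x y := fun x hx y hy =>
    Icc_subset_uIcc ⟨hx.2, (not_le.1 fun h => hy.2 ⟨hy.1, h⟩).le⟩
  have hcross : ∀ x ∈ S ∩ Iic p, ∀ y ∈ S \ (S ∩ Iic p), dOf f x y = 0 → x = p := by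
    intro x hx y hy hxy
    by_contra hne
    exact (hhit x hx.1 (lt_of_le_of_ne hx.2 hne)).not_ge
      (le_of_dOf_eq_zero hS hf hx.1 hy.1 hxy (hsep x hx y hy)).1
  exact quotDistOn_eq_of_cut hS hg inter_subset_left ⟨hp, by simp⟩ hsep (dOf_self f) hfg hcross
    (fun x hx y hy hxy => hcross x hx y hy (dOf_comm f x y ▸ hxy)) hs ht

lemma Dquot_inter_Ici (hS : S.OrdConnected) (hf : ContinuousOn f S) (hg : ContinuousOn g S)
    (hfg : ∀ s ∈ S, ∀ t ∈ S, dOf f s t = 0 → g s = g t) (hp : p ∈ S)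
    (hhit : ∀ t ∈ S, t < p → f p < f t) (hs : s ∈ S ∩ Ici p) (ht : t ∈ S ∩ Ici p) :
    Dquot f g (S ∩ Ici p) s t = Dquot f g S s t := by
  have hlt : ∀ y ∈ S \ (S ∩ Ici p), y < p := fun y hy => not_le.1 fun h => hy.2 ⟨hy.1, h⟩
  have hsep : ∀ x ∈ S ∩ Ici p, ∀ y ∈ S \ (S ∩ Ici p), p ∈ uIcc x y := fun x hx y hy =>
    Icc_subset_uIcc' ⟨(hlt y hy).le, hx.2⟩
  have hcross : ∀ x ∈ S ∩ Ici p, ∀ y ∈ S \ (S ∩ Ici p), dOf f x y = 0 → x = p :=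
    fun x hx y hy hxy => absurd (hhit y hy.1 (hlt y hy))
      (le_of_dOf_eq_zero hS hf hx.1 hy.1 hxy (hsep x hx y hy)).2.not_gt
  exact quotDistOn_eq_of_cut hS hg inter_subset_left ⟨hp, by simp⟩ hsep (dOf_self f) hfg hcross
    (fun x hx y hy hxy => hcross x hx y hy (dOf_comm f x y ▸ hxy)) hs ht

end OneSided

/-- the quotient pseudometric computed from the restriction of a slice
trajectory to the window `[T_L, T_{L'}] ∩ I` is the restriction of the quotient
pseudometric computed from `(f,g)`. -/
theorem slice_restriction
    (I : Set ℝ) (f g : ℝ → ℝ) (h : IsSliceTrajectory I f g)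
    (L L' : EReal) (hLtop : L ≠ ⊤) (hL'bot : L' ≠ ⊥) (hLL' : L ≤ L')
    (hlow : ∀ _ : BddBelow I, ((-f (sInf I) : ℝ) : EReal) ≤ L)
    (hup : (⨅ t ∈ I, (f t : EReal)) ≤ -L') :
    ∀ s ∈ sliceWindow I f L L', ∀ t ∈ sliceWindow I f L L',
      Dquot f g (sliceWindow I f L L') s t = Dquot f g I s t := by
  intro s hs t ht
  have hI := h
  obtain ⟨-, hIc, -, hf, hg, hfg, -, -⟩ := hI
  have hupper : ∃ S : Set ℝ, S = {t | t ∈ I ∧ ∀ l : ℝ, L' = (l : EReal) → t ≤ hitT I f l} ∧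
      S.OrdConnected ∧ ∀ s ∈ S, ∀ t ∈ S, Dquot f g S s t = Dquot f g I s t := by
    refine ⟨_, rfl, ?_⟩
    induction L' with
    | bot => exact absurd rfl hL'bot
    | top => simpa using hIc
    | coe l' =>
      obtain ⟨hmem, hval, hleft⟩ := h.hitT_spec hlow hup hLL' le_rfl
      have hset : {t | t ∈ I ∧ ∀ l : ℝ, (l' : EReal) = (l : EReal) → t ≤ hitT I f l} =
          I ∩ Iic (hitT I f l') := by
        ext t
        simp
      rw [hset]
      exact ⟨hIc.inter ordConnected_Iic, fun s hs t ht =>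
        Dquot_inter_Iic hIc hf hg hfg hmem (fun t ht htT => hval ▸ hleft t ht htT) hs ht⟩
  obtain ⟨S, hSdef, hSc, hSI⟩ := hupper
  have hsub : S ⊆ I := fun t ht => by
    rw [hSdef] at ht
    exact ht.1
  have hW : sliceWindow I f L L' = {t | t ∈ S ∧ ∀ l : ℝ, L = (l : EReal) → hitT I f l ≤ t} := by
    ext t
    simp only [sliceWindow, hSdef, mem_ofPred_eq]
    tauto
  rw [hW] at hs ht ⊢
  rw [← hSI s hs.1 t ht.1]
  induction L with
  | top => exact absurd rfl hLtop
  | bot => simp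
  | coe l =>
    obtain ⟨hmem, hval, hleft⟩ := h.hitT_spec hlow hup le_rfl hLL'
    have hset : {t | t ∈ S ∧ ∀ l₁ : ℝ, (l : EReal) = (l₁ : EReal) → hitT I f l₁ ≤ t} =
        S ∩ Ici (hitT I f l) := by
      ext t
      simp
    rw [hset] at hs ht ⊢
    have hmemS : hitT I f l ∈ S := by
      rw [hSdef]
      refine ⟨hmem, fun l' hl' => ?_⟩
      subst hl'
      obtain ⟨hmem', hval', -⟩ := h.hitT_spec hlow hup hLL' le_rfl
      by_contra! hlt
      have h1 := hleft _ hmem' hlt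
      have h2 : l ≤ l' := EReal.coe_le_coe_iff.1 hLL'
      linarith
    exact Dquot_inter_Ici hSc (hf.mono hsub) (hg.mono hsub)
      (fun s hs t ht => hfg s (hsub hs) t (hsub ht)) hmemS
      (fun t ht htT => hval ▸ hleft t (hsub ht) htT) hs ht
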